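/- arXiv:2011.00358 — 5 statements merged into one kernel-verified Lean document; each statement's English description precedes it below -/
import Mathlib

section
/- Let 𝕀 : ℝ → ℝ be a continuous polynomially bounded function, and let 𝕃 : ℝ → ℝ be a C² function such that 𝕃, 𝕃', 𝕃'' are polynomially bounded and 𝕃''(t) − W''(ℍ(t)) 𝕃(t) = W'''(ℍ(t)) 𝕀(t)² for all t. Then ∫_ℝ W'''(ℍ(t)) 𝕃(t) (ℍ'(t))² dt = ∫_ℝ ℍ''(t) W'''(ℍ(t)) 𝕀(t)² dt. -/
open MeasureTheory Filter

/-- A polynomial times a decaying exponential is dominated by `1 / (1 + t ^ 2)`. -/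
lemma exists_one_add_abs_pow_mul_exp_le {a : ℝ} (ha : 0 < a) (m : ℕ) :
    ∃ K : ℝ, ∀ t : ℝ, (1 + |t|) ^ m * Real.exp (-a * |t|) ≤ K * (1 + t ^ 2)⁻¹ := by
  refine ⟨(m + 2).factorial * Real.exp a / a ^ (m + 2), fun t => ?_⟩
  have hu : 0 ≤ |t| := abs_nonneg t
  have h := Real.pow_div_factorial_le_exp (a * (1 + |t|)) (by positivity) (m + 2)
  rw [div_le_iff₀ (by positivity), mul_pow, mul_add, mul_one, Real.exp_add] at h
  rw [← div_eq_mul_inv, div_div, le_div_iff₀ (by positivity)]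
  have hsq : 1 + t ^ 2 ≤ (1 + |t|) ^ 2 := by
    rw [← sq_abs]
    nlinarith
  have hexp : Real.exp (-a * |t|) * Real.exp (a * |t|) = 1 := by
    rw [← Real.exp_add]
    simp
  calc (1 + |t|) ^ m * Real.exp (-a * |t|) * (a ^ (m + 2) * (1 + t ^ 2))
      ≤ (1 + |t|) ^ m * Real.exp (-a * |t|) * (a ^ (m + 2) * (1 + |t|) ^ 2) := by gcongr
    _ = Real.exp (-a * |t|) * (a ^ (m + 2) * (1 + |t|) ^ (m + 2)) := by ring
    _ ≤ Real.exp (-a * |t|) *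
          (Real.exp a * Real.exp (a * |t|) * (m + 2).factorial) := by gcongr
    _ = (m + 2).factorial * Real.exp a * (Real.exp (-a * |t|) * Real.exp (a * |t|)) := by ring
    _ = (m + 2).factorial * Real.exp a := by rw [hexp, mul_one]

lemma exists_abs_le_mul_inv_one_add_sq {f : ℝ → ℝ} {a K : ℝ} {m : ℕ} (ha : 0 < a) (hK : 0 ≤ K)
    (h : ∀ t, |f t| ≤ K * ((1 + |t|) ^ m * Real.exp (-a * |t|))) :
    ∃ K' : ℝ, ∀ t, |f t| ≤ K' * (1 + t ^ 2)⁻¹ := by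
  obtain ⟨K', hK'⟩ := exists_one_add_abs_pow_mul_exp_le ha m
  refine ⟨K * K', fun t => (h t).trans ?_⟩
  rw [mul_assoc]
  exact mul_le_mul_of_nonneg_left (hK' t) hK

lemma integrable_of_abs_le_pow_mul_exp {f : ℝ → ℝ} {a K : ℝ} {m : ℕ} (hf : Continuous f)
    (ha : 0 < a) (hK : 0 ≤ K)
    (h : ∀ t, |f t| ≤ K * ((1 + |t|) ^ m * Real.exp (-a * |t|))) : Integrable f := by
  obtain ⟨K', hK'⟩ := exists_abs_le_mul_inv_one_add_sq ha hK h
  exact (integrable_inv_one_add_sq.const_mul K').mono' hf.aestronglyMeasurable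
    (Eventually.of_forall hK')

lemma tendsto_zero_of_abs_le_pow_mul_exp {f : ℝ → ℝ} {a K : ℝ} {m : ℕ}
    (ha : 0 < a) (hK : 0 ≤ K)
    (h : ∀ t, |f t| ≤ K * ((1 + |t|) ^ m * Real.exp (-a * |t|))) :
    Tendsto f (atBot ⊔ atTop) (nhds 0) := by
  obtain ⟨K', hK'⟩ := exists_abs_le_mul_inv_one_add_sq ha hK h
  refine squeeze_zero_norm hK' ?_
  have hsq : Tendsto (fun t : ℝ => t ^ 2) (atBot ⊔ atTop) atTop := by
    have habs := tendsto_sup.2 ⟨tendsto_abs_atBot_atTop (G := ℝ), tendsto_abs_atTop_atTop⟩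
    simpa [Function.comp_def] using (tendsto_pow_atTop two_ne_zero).comp habs
  simpa using (tendsto_inv_atTop_zero.comp (tendsto_atTop_add_const_left _ 1 hsq)).const_mul K'

/-- A continuous function is bounded along any function with values in `(-1, 1)`. -/
lemma exists_abs_comp_le {g H : ℝ → ℝ} (hg : Continuous g)
    (hH : ∀ t, H t ∈ Set.Ioo (-1 : ℝ) 1) : ∃ M, 0 ≤ M ∧ ∀ t, |g (H t)| ≤ M := by
  obtain ⟨M, hM⟩ := isCompact_Icc.exists_bound_of_continuousOn (s := Set.Icc (-1 : ℝ) 1)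
    hg.continuousOn
  have hb : ∀ t, |g (H t)| ≤ M := fun t => hM _ (Set.Ioo_subset_Icc_self (hH t))
  exact ⟨M, (abs_nonneg _).trans (hb 0), hb⟩

lemma hasDerivAt_iteratedDeriv {f : ℝ → ℝ} {n k : ℕ} (hf : ContDiff ℝ n f) (hk : k < n)
    (x : ℝ) : HasDerivAt (iteratedDeriv k f) (iteratedDeriv (k + 1) f x) x := by
  rw [iteratedDeriv_succ]
  exact (hf.differentiable_iteratedDeriv k (by exact_mod_cast hk) x).hasDerivAt

/-- if `𝕃'' − W''(ℍ)𝕃 = W'''(ℍ)𝕀²` with `𝕀` continuous polynomially bounded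
and `𝕃, 𝕃', 𝕃''` polynomially bounded, then `∫ W'''(ℍ) 𝕃 (ℍ')² = ∫ ℍ'' W'''(ℍ) 𝕀²`. -/
theorem integral_Wppp_L_eq_integral_Hpp_Wppp_I_sq
    (W ℍ : ℝ → ℝ)
    (hWsmooth : ContDiff ℝ (⊤ : ℕ∞) W)
    (hWnonneg : ∀ x, 0 ≤ W x)
    (hWzero : ∀ x, W x = 0 ↔ x = 1 ∨ x = -1)
    (hW'zero : deriv W 0 = 0)
    (hW''zero : iteratedDeriv 2 W 0 ≠ 0)
    (hWwell : ∀ x : ℝ, 0 < |x| → |x| < 1 → x * deriv W x < 0)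
    (hWconv : ∃ κ > (0:ℝ), ∃ β ∈ Set.Ioo (0:ℝ) 1, ∀ x : ℝ, 1 - β ≤ |x| → κ ≤ iteratedDeriv 2 W x)
    (hWsymm : ∀ x, W (-x) = W x)
    (hHsmooth : ContDiff ℝ (⊤ : ℕ∞) ℍ)
    (hHrange : ∀ t, ℍ t ∈ Set.Ioo (-1:ℝ) 1)
    (hHode : ∀ t, iteratedDeriv 2 ℍ t = deriv W (ℍ t))
    (hHzero : ℍ 0 = 0)
    (hHmono : ∀ t, 0 < deriv ℍ t)
    (hHtop : Filter.Tendsto ℍ Filter.atTop (nhds 1))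
    (hHbot : Filter.Tendsto ℍ Filter.atBot (nhds (-1)))
    (hdecay : ∃ C > (0:ℝ), ∃ a > (0:ℝ), ∀ t : ℝ,
      |deriv ℍ t| + |iteratedDeriv 2 ℍ t| ≤ C * Real.exp (-a * |t|))
    (𝕀 : ℝ → ℝ) (hI : Continuous 𝕀)
    (hIpoly : ∃ C' > (0:ℝ), ∃ m : ℕ, ∀ t : ℝ, |𝕀 t| ≤ C' * (1 + |t|) ^ m)
    (𝕃 : ℝ → ℝ) (hL : ContDiff ℝ 2 𝕃)
    (hLpoly : ∃ C' > (0:ℝ), ∃ m : ℕ, ∀ t : ℝ,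
      |𝕃 t| + |deriv 𝕃 t| + |iteratedDeriv 2 𝕃 t| ≤ C' * (1 + |t|) ^ m)
    (hLode : ∀ t : ℝ, iteratedDeriv 2 𝕃 t - iteratedDeriv 2 W (ℍ t) * 𝕃 t
      = iteratedDeriv 3 W (ℍ t) * (𝕀 t) ^ 2) :
    (∫ t : ℝ, iteratedDeriv 3 W (ℍ t) * 𝕃 t * (deriv ℍ t) ^ 2)
      = ∫ t : ℝ, iteratedDeriv 2 ℍ t * (iteratedDeriv 3 W (ℍ t) * (𝕀 t) ^ 2) := by
  obtain ⟨C, hC, a, ha, hdec⟩ := hdecay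
  obtain ⟨A, hA, p, hIp⟩ := hIpoly
  obtain ⟨B, hB, q, hLq⟩ := hLpoly
  have hW3 : ContDiff ℝ (3 : ℕ) W := contDiff_infty.1 hWsmooth 3
  have hH2 : ContDiff ℝ (2 : ℕ) ℍ := contDiff_infty.1 hHsmooth 2
  have hcW2 : Continuous (iteratedDeriv 2 W) := hW3.continuous_iteratedDeriv 2 (by norm_num)
  have hcW3 : Continuous (iteratedDeriv 3 W) := hW3.continuous_iteratedDeriv 3 (by norm_num)
  have hcH : Continuous ℍ := hH2.continuous
  have hcH1 : Continuous (deriv ℍ) := hH2.continuous_deriv (by norm_num)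
  have hcH2 : Continuous (iteratedDeriv 2 ℍ) := hH2.continuous_iteratedDeriv 2 (by norm_num)
  have hcL : Continuous 𝕃 := hL.continuous
  have hdH (t : ℝ) : HasDerivAt ℍ (deriv ℍ t) t := by
    simpa using hasDerivAt_iteratedDeriv (k := 0) hH2 (by norm_num) t
  have hdH1 (t : ℝ) : HasDerivAt (deriv ℍ) (iteratedDeriv 2 ℍ t) t := by
    simpa using hasDerivAt_iteratedDeriv (k := 1) hH2 (by norm_num) t
  have hdL (t : ℝ) : HasDerivAt 𝕃 (deriv 𝕃 t) t := by
    simpa using hasDerivAt_iteratedDeriv (n := 2) (k := 0) hL (by norm_num) t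
  have hdL1 (t : ℝ) : HasDerivAt (deriv 𝕃) (iteratedDeriv 2 𝕃 t) t := by
    simpa using hasDerivAt_iteratedDeriv (n := 2) (k := 1) hL (by norm_num) t
  have hdW1 (x : ℝ) : HasDerivAt (deriv W) (iteratedDeriv 2 W x) x := by
    simpa using hasDerivAt_iteratedDeriv (k := 1) hW3 (by norm_num) x
  have hdW2 (x : ℝ) : HasDerivAt (iteratedDeriv 2 W) (iteratedDeriv 3 W x) x :=
    hasDerivAt_iteratedDeriv hW3 (by norm_num) x
  have hdH2 (t : ℝ) : HasDerivAt (iteratedDeriv 2 ℍ) (iteratedDeriv 2 W (ℍ t) * deriv ℍ t) t := by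
    rw [funext hHode]
    exact (hdW1 (ℍ t)).comp t (hdH t)
  have hdH3 (t : ℝ) := ((hdW2 (ℍ t)).comp t (hdH t)).mul (hdH1 t)
  obtain ⟨M₂, hM₂0, hM₂⟩ := exists_abs_comp_le hcW2 hHrange
  obtain ⟨M₃, hM₃0, hM₃⟩ := exists_abs_comp_le hcW3 hHrange
  have hH1le (t : ℝ) : |deriv ℍ t| ≤ C * Real.exp (-a * |t|) := by
    linarith [hdec t, abs_nonneg (iteratedDeriv 2 ℍ t)]
  have hH2le (t : ℝ) : |iteratedDeriv 2 ℍ t| ≤ C * Real.exp (-a * |t|) := by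
    linarith [hdec t, abs_nonneg (deriv ℍ t)]
  have hLle (t : ℝ) : |𝕃 t| ≤ B * (1 + |t|) ^ q := by
    linarith [hLq t, abs_nonneg (deriv 𝕃 t), abs_nonneg (iteratedDeriv 2 𝕃 t)]
  have hL1le (t : ℝ) : |deriv 𝕃 t| ≤ B * (1 + |t|) ^ q := by
    linarith [hLq t, abs_nonneg (𝕃 t), abs_nonneg (iteratedDeriv 2 𝕃 t)]
  have hint₁ : Integrable fun t => iteratedDeriv 3 W (ℍ t) * 𝕃 t * (deriv ℍ t) ^ 2 := by
    refine integrable_of_abs_le_pow_mul_exp (K := M₃ * B * C ^ 2) (m := q) (by fun_prop) ha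
      (by positivity) fun t => ?_
    have hexp : Real.exp (-a * |t|) ≤ 1 := by
      rw [Real.exp_le_one_iff]
      nlinarith [abs_nonneg t]
    have hsq : |deriv ℍ t| ^ 2 ≤ C ^ 2 * Real.exp (-a * |t|) := by
      calc |deriv ℍ t| ^ 2 ≤ (C * Real.exp (-a * |t|)) ^ 2 := by
            gcongr
            exact hH1le t
        _ = C ^ 2 * (Real.exp (-a * |t|) * Real.exp (-a * |t|)) := by ring
        _ ≤ C ^ 2 * (Real.exp (-a * |t|) * 1) := by gcongr
        _ = C ^ 2 * Real.exp (-a * |t|) := by ring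
    rw [abs_mul, abs_mul, abs_pow]
    calc |iteratedDeriv 3 W (ℍ t)| * |𝕃 t| * |deriv ℍ t| ^ 2
        ≤ M₃ * (B * (1 + |t|) ^ q) * (C ^ 2 * Real.exp (-a * |t|)) := by
          gcongr
          exacts [hM₃ t, hLle t]
      _ = M₃ * B * C ^ 2 * ((1 + |t|) ^ q * Real.exp (-a * |t|)) := by ring
  have hint₂ : Integrable fun t =>
      iteratedDeriv 2 ℍ t * (iteratedDeriv 3 W (ℍ t) * (𝕀 t) ^ 2) := by
    refine integrable_of_abs_le_pow_mul_exp (K := C * M₃ * A ^ 2) (m := p * 2) (by fun_prop) ha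
      (by positivity) fun t => ?_
    rw [abs_mul, abs_mul, abs_pow]
    calc |iteratedDeriv 2 ℍ t| * (|iteratedDeriv 3 W (ℍ t)| * |𝕀 t| ^ 2)
        ≤ C * Real.exp (-a * |t|) * (M₃ * (A * (1 + |t|) ^ p) ^ 2) := by
          gcongr
          exacts [hH2le t, hM₃ t, hIp t]
      _ = C * M₃ * A ^ 2 * ((1 + |t|) ^ (p * 2) * Real.exp (-a * |t|)) := by
          rw [pow_mul]
          ring
  have htend : Tendsto (fun t => 𝕃 t * (iteratedDeriv 2 W (ℍ t) * deriv ℍ t)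
      - iteratedDeriv 2 ℍ t * deriv 𝕃 t) (atBot ⊔ atTop) (nhds 0) := by
    refine tendsto_zero_of_abs_le_pow_mul_exp (K := B * C * (M₂ + 1)) (m := q) ha
      (by positivity) fun t => (abs_sub _ _).trans ?_
    rw [abs_mul, abs_mul, abs_mul]
    calc |𝕃 t| * (|iteratedDeriv 2 W (ℍ t)| * |deriv ℍ t|) + |iteratedDeriv 2 ℍ t| * |deriv 𝕃 t|
        ≤ B * (1 + |t|) ^ q * (M₂ * (C * Real.exp (-a * |t|)))
            + C * Real.exp (-a * |t|) * (B * (1 + |t|) ^ q) := by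
          gcongr
          exacts [hLle t, hM₂ t, hH1le t, hH2le t, hL1le t]
      _ = B * C * (M₂ + 1) * ((1 + |t|) ^ q * Real.exp (-a * |t|)) := by ring
  have hderiv (t : ℝ) : HasDerivAt (fun t => 𝕃 t * (iteratedDeriv 2 W (ℍ t) * deriv ℍ t)
      - iteratedDeriv 2 ℍ t * deriv 𝕃 t)
      (iteratedDeriv 3 W (ℍ t) * 𝕃 t * (deriv ℍ t) ^ 2
        - iteratedDeriv 2 ℍ t * (iteratedDeriv 3 W (ℍ t) * (𝕀 t) ^ 2)) t := by
    refine (((hdL t).mul (hdH3 t)).sub ((hdH2 t).mul (hdL1 t))).congr_deriv ?_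
    rw [← hLode t]
    simp only [Function.comp_apply, Pi.mul_apply]
    ring
  rw [← sub_eq_zero, ← integral_sub hint₁ hint₂]
  simpa using integral_of_hasDerivAt_of_tendsto hderiv (hint₁.sub hint₂)
    (htend.mono_left le_sup_left) (htend.mono_left le_sup_right)
end

section
/- Assume there are C, a > 0 with |ℍ'(t)| ≤ C e^{−a|t|} for all t ∈ ℝ. Then for every k ∈ ℕ and every ℓ ∈ ℕ with ℓ ≥ 1, one has sup_{t ∈ ℝ} |t|^k |ℍ^{(ℓ)}(t)| < ∞, where ℍ^{(ℓ)} denotes the ℓ-th derivative of ℍ. -/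
open Filter

/-- `f` is bounded by a multiple of `e^{−a|t|}`. -/
def HasExpDecay (a : ℝ) (f : ℝ → ℝ) : Prop :=
  ∃ M : ℝ, ∀ t : ℝ, |f t| ≤ M * Real.exp (-a * |t|)

/-- Exponential decay beats every power. -/
lemma HasExpDecay.exists_pow_mul_le {a : ℝ} (ha : 0 < a) {f : ℝ → ℝ} (hf : HasExpDecay a f)
    (k : ℕ) : ∃ M : ℝ, ∀ t : ℝ, |t| ^ k * |f t| ≤ M := by
  obtain ⟨M, hM⟩ := hf
  have hM0 : 0 ≤ M := by simpa using (abs_nonneg _).trans (hM 0)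
  refine ⟨k.factorial / a ^ k * M, fun t => ?_⟩
  have h1 := Real.pow_div_factorial_le_exp (a * |t|) (by positivity) k
  have h2 : |t| ^ k ≤ k.factorial / a ^ k * Real.exp (a * |t|) := by
    rw [mul_pow, div_le_iff₀ (by positivity)] at h1
    rw [div_mul_eq_mul_div, le_div_iff₀ (by positivity)]
    linarith
  have h3 : Real.exp (a * |t|) * Real.exp (-a * |t|) = 1 := by
    rw [← Real.exp_add]; simp
  calc |t| ^ k * |f t|
      ≤ (k.factorial / a ^ k * Real.exp (a * |t|)) * (M * Real.exp (-a * |t|)) := by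
        gcongr
        exact hM t
    _ = k.factorial / a ^ k * M * (Real.exp (a * |t|) * Real.exp (-a * |t|)) := by ring
    _ = k.factorial / a ^ k * M := by rw [h3, mul_one]

/-- If a function and its second derivative decay exponentially, so does its derivative. -/
lemma HasExpDecay.deriv_of_deriv_deriv {a : ℝ} (ha : 0 < a) {f : ℝ → ℝ}
    (hf : Differentiable ℝ f) (hf' : Differentiable ℝ (deriv f))
    (h0 : HasExpDecay a f) (h2 : HasExpDecay a (deriv (deriv f))) :
    HasExpDecay a (deriv f) := by
  obtain ⟨A, hA⟩ := h0
  obtain ⟨B, hB⟩ := h2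
  have hA0 : 0 ≤ A := by simpa using (abs_nonneg _).trans (hA 0)
  have hB0 : 0 ≤ B := by simpa using (abs_nonneg _).trans (hB 0)
  refine ⟨A * Real.exp a + A + B * Real.exp a, fun t => ?_⟩
  have hshift : ∀ s, t ≤ s → s ≤ t + 1 →
      Real.exp (-a * |s|) ≤ Real.exp a * Real.exp (-a * |t|) := by
    intro s h1 h2
    rw [← Real.exp_add, Real.exp_le_exp]
    have : |t| ≤ |s| + 1 := by
      have := abs_sub_abs_le_abs_sub t s
      have : |t - s| ≤ 1 := abs_le.2 ⟨by linarith, by linarith⟩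
      linarith
    nlinarith
  obtain ⟨s, ⟨hs1, hs2⟩, hs⟩ := exists_deriv_eq_slope f (lt_add_one t)
    hf.continuous.continuousOn hf.differentiableOn
  obtain ⟨r, ⟨hr1, hr2⟩, hr⟩ := exists_deriv_eq_slope (deriv f) hs1
    hf'.continuous.continuousOn hf'.differentiableOn
  rw [eq_div_iff (by linarith)] at hr
  have hs' : deriv f s = f (t + 1) - f t := by simpa using hs
  have key : deriv f t = f (t + 1) - f t - deriv (deriv f) r * (s - t) := by linarith
  have b1 : |f (t + 1)| ≤ A * (Real.exp a * Real.exp (-a * |t|)) :=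
    (hA _).trans (by gcongr; exact hshift _ (by linarith) le_rfl)
  have b2 : |deriv (deriv f) r * (s - t)| ≤ B * (Real.exp a * Real.exp (-a * |t|)) := by
    rw [abs_mul, abs_of_pos (sub_pos.2 hs1)]
    calc _ ≤ |deriv (deriv f) r| * 1 := by gcongr; linarith
      _ = |deriv (deriv f) r| := mul_one _
      _ ≤ B * Real.exp (-a * |r|) := hB r
      _ ≤ _ := by gcongr; exact hshift _ hr1.le (by linarith)
  rw [key]
  have := abs_sub (f (t + 1) - f t) (deriv (deriv f) r * (s - t))
  have := abs_sub (f (t + 1)) (f t)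
  have := hA t
  linarith

/-- Derivatives of `g ∘ f` are bounded if `f` takes values in a compact interval and has bounded
derivatives. -/
lemma exists_bound_iteratedDeriv_comp {g f : ℝ → ℝ} (hg : ContDiff ℝ (⊤ : ℕ∞) g)
    (hf : ContDiff ℝ (⊤ : ℕ∞) f) {b c : ℝ} (hrange : ∀ t, f t ∈ Set.Icc b c) (n : ℕ)
    (hbound : ∀ j, 1 ≤ j → j ≤ n → ∃ M : ℝ, ∀ t, |iteratedDeriv j f t| ≤ M) :
    ∃ K : ℝ, ∀ t, |iteratedDeriv n (g ∘ f) t| ≤ K := by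
  have hG : ∀ i : ℕ, ∃ C : ℝ, ∀ x ∈ Set.Icc b c, ‖iteratedFDeriv ℝ i g x‖ ≤ C := fun i =>
    isCompact_Icc.exists_bound_of_continuousOn
      (hg.continuous_iteratedFDeriv (by exact_mod_cast le_top)).continuousOn
  choose C hC using hG
  have hF : ∀ j : ℕ, ∃ M : ℝ, 1 ≤ j → j ≤ n → ∀ t, |iteratedDeriv j f t| ≤ M := by
    intro j
    by_cases h : 1 ≤ j ∧ j ≤ n
    · obtain ⟨M, hM⟩ := hbound j h.1 h.2
      exact ⟨M, fun _ _ => hM⟩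
    · exact ⟨0, fun h1 h2 => absurd ⟨h1, h2⟩ h⟩
  choose M hM using hF
  set C' := ∑ i ∈ Finset.range (n + 1), |C i|
  set D := 1 + ∑ i ∈ Finset.range (n + 1), |M i|
  have hD1 : 1 ≤ D := le_add_of_nonneg_right (Finset.sum_nonneg fun _ _ => abs_nonneg _)
  refine ⟨n.factorial * C' * D ^ n, fun t => ?_⟩
  rw [← Real.norm_eq_abs, ← norm_iteratedFDeriv_eq_norm_iteratedDeriv]
  refine norm_iteratedFDeriv_comp_le hg hf (by exact_mod_cast le_top) t ?_ ?_
  · intro i hi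
    have := Finset.single_le_sum (f := fun i => |C i|) (fun _ _ => abs_nonneg _)
      (Finset.mem_range.2 (Nat.lt_succ_of_le hi))
    exact (hC i _ (hrange t)).trans ((le_abs_self _).trans this)
  · intro i hi1 hi
    have := Finset.single_le_sum (f := fun i => |M i|) (fun _ _ => abs_nonneg _)
      (Finset.mem_range.2 (Nat.lt_succ_of_le hi))
    rw [norm_iteratedFDeriv_eq_norm_iteratedDeriv, Real.norm_eq_abs]
    calc |iteratedDeriv i f t| ≤ M i := hM i hi1 hi t
      _ ≤ |M i| := le_abs_self _
      _ ≤ D := by linarith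
      _ ≤ D ^ i := le_self_pow₀ hD1 (by omega)

/-- Leibniz: bounded derivatives times exponentially decaying derivatives decay exponentially. -/
lemma HasExpDecay.iteratedDeriv_mul {a : ℝ} {u v : ℝ → ℝ} (hu : ContDiff ℝ (⊤ : ℕ∞) u)
    (hv : ContDiff ℝ (⊤ : ℕ∞) v) (n : ℕ)
    (hub : ∀ i ≤ n, ∃ K : ℝ, ∀ t, |iteratedDeriv i u t| ≤ K)
    (hvb : ∀ i ≤ n, HasExpDecay a (iteratedDeriv i v)) :
    HasExpDecay a (iteratedDeriv n fun t => u t * v t) := by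
  choose! K hK using hub
  choose! M hM using hvb
  refine ⟨∑ i ∈ Finset.range (n + 1), (n.choose i : ℝ) * K i * M (n - i), fun t => ?_⟩
  rw [← Real.norm_eq_abs, ← norm_iteratedFDeriv_eq_norm_iteratedDeriv]
  refine (norm_iteratedFDeriv_mul_le hu hv t (by exact_mod_cast le_top)).trans ?_
  rw [Finset.sum_mul]
  refine Finset.sum_le_sum fun i hi => ?_
  have hi : i ≤ n := Nat.lt_succ_iff.1 (Finset.mem_range.1 hi)
  have hK0 : 0 ≤ K i := (abs_nonneg _).trans (hK i hi t)
  simp only [norm_iteratedFDeriv_eq_norm_iteratedDeriv, Real.norm_eq_abs]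
  rw [mul_assoc _ (M (n - i))]
  gcongr
  · exact hK i hi t
  · exact hM (n - i) (Nat.sub_le n i) t

lemma HasExpDecay.exists_bound {a : ℝ} (ha : 0 < a) {f : ℝ → ℝ} (hf : HasExpDecay a f) :
    ∃ M : ℝ, ∀ t, |f t| ≤ M := by
  simpa using hf.exists_pow_mul_le ha 0

/-- Differentiating `f'' = g(f)` bounds the derivative of order `n + 3` by those of order
`1, …, n + 1`. -/
lemma HasExpDecay.iteratedDeriv_add_three {a : ℝ} (ha : 0 < a) {g f : ℝ → ℝ}
    (hg : ContDiff ℝ (⊤ : ℕ∞) g) (hf : ContDiff ℝ (⊤ : ℕ∞) f) {b c : ℝ}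
    (hrange : ∀ t, f t ∈ Set.Icc b c) (hode : ∀ t, iteratedDeriv 2 f t = g (f t)) (n : ℕ)
    (h : ∀ j, 1 ≤ j → j ≤ n + 1 → HasExpDecay a (iteratedDeriv j f)) :
    HasExpDecay a (iteratedDeriv (n + 3) f) := by
  have hg' : ContDiff ℝ (⊤ : ℕ∞) (deriv g) := (contDiff_infty_iff_deriv.1 hg).2
  have hf' : ContDiff ℝ (⊤ : ℕ∞) (deriv f) := (contDiff_infty_iff_deriv.1 hf).2
  have h3 : iteratedDeriv 3 f = fun t => (deriv g ∘ f) t * deriv f t := by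
    have h2 : iteratedDeriv 2 f = g ∘ f := funext hode
    rw [iteratedDeriv_succ, h2]
    ext t
    exact deriv_comp t (hg.differentiable (by simp) _) (hf.differentiable (by simp) _)
  have hsplit : iteratedDeriv (n + 3) f = iteratedDeriv n (iteratedDeriv 3 f) := by
    simp only [iteratedDeriv_eq_iterate, Function.iterate_add_apply]
  rw [hsplit, h3]
  refine HasExpDecay.iteratedDeriv_mul (hg'.comp hf) hf' n (fun i hi => ?_) fun i hi => ?_
  · exact exists_bound_iteratedDeriv_comp hg' hf hrange i fun j hj1 hj =>
      (h j hj1 (by omega)).exists_bound ha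
  · rw [← iteratedDeriv_succ']
    exact h (i + 1) (by omega) (by omega)

/-- All derivatives of a bounded solution of `f'' = g(f)` decay exponentially if the first one
does. -/
lemma HasExpDecay.iteratedDeriv_of_ode {a : ℝ} (ha : 0 < a) {g f : ℝ → ℝ}
    (hg : ContDiff ℝ (⊤ : ℕ∞) g) (hf : ContDiff ℝ (⊤ : ℕ∞) f) {b c : ℝ}
    (hrange : ∀ t, f t ∈ Set.Icc b c) (hode : ∀ t, iteratedDeriv 2 f t = g (f t))
    (h1 : HasExpDecay a (deriv f)) (ℓ : ℕ) (hℓ : 1 ≤ ℓ) :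
    HasExpDecay a (iteratedDeriv ℓ f) := by
  have hf' : ContDiff ℝ (⊤ : ℕ∞) (deriv f) := (contDiff_infty_iff_deriv.1 hf).2
  have hf'' : ContDiff ℝ (⊤ : ℕ∞) (deriv (deriv f)) := (contDiff_infty_iff_deriv.1 hf').2
  induction ℓ using Nat.strong_induction_on with
  | _ ℓ ih =>
    match ℓ, hℓ with
    | 1, _ => rwa [iteratedDeriv_one]
    | 2, _ =>
      have h3 := HasExpDecay.iteratedDeriv_add_three ha hg hf hrange hode 0 fun j hj1 hj => by
        obtain rfl : j = 1 := by omega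
        rwa [iteratedDeriv_one]
      simp only [iteratedDeriv_succ, iteratedDeriv_zero] at h3 ⊢
      exact HasExpDecay.deriv_of_deriv_deriv ha (hf'.differentiable (by simp))
        (hf''.differentiable (by simp)) h1 h3
    | n + 3, _ =>
      exact HasExpDecay.iteratedDeriv_add_three ha hg hf hrange hode n fun j hj1 hj =>
        ih j (by omega) hj1

/-- if `|ℍ'(t)| ≤ C e^{−a|t|}`, then for every `k` and every `ℓ ≥ 1`,
`sup_t |t|^k |ℍ^{(ℓ)}(t)| < ∞`. -/
theorem polynomial_times_derivative_of_heteroclinic_bounded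
    (W ℍ : ℝ → ℝ)
    (hWsmooth : ContDiff ℝ (⊤ : ℕ∞) W)
    (hWnonneg : ∀ x, 0 ≤ W x)
    (hWzero : ∀ x, W x = 0 ↔ x = 1 ∨ x = -1)
    (hW'zero : deriv W 0 = 0)
    (hW''zero : iteratedDeriv 2 W 0 ≠ 0)
    (hWwell : ∀ x : ℝ, 0 < |x| → |x| < 1 → x * deriv W x < 0)
    (hWconv : ∃ κ > (0:ℝ), ∃ β ∈ Set.Ioo (0:ℝ) 1, ∀ x : ℝ, 1 - β ≤ |x| → κ ≤ iteratedDeriv 2 W x)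
    (hWsymm : ∀ x, W (-x) = W x)
    (hHsmooth : ContDiff ℝ (⊤ : ℕ∞) ℍ)
    (hHrange : ∀ t, ℍ t ∈ Set.Ioo (-1:ℝ) 1)
    (hHode : ∀ t, iteratedDeriv 2 ℍ t = deriv W (ℍ t))
    (hHzero : ℍ 0 = 0)
    (hHmono : ∀ t, 0 < deriv ℍ t)
    (hHtop : Filter.Tendsto ℍ Filter.atTop (nhds 1))
    (hHbot : Filter.Tendsto ℍ Filter.atBot (nhds (-1)))
    (hdecay : ∃ C > (0:ℝ), ∃ a > (0:ℝ), ∀ t : ℝ, |deriv ℍ t| ≤ C * Real.exp (-a * |t|)) :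
    ∀ k ℓ : ℕ, 1 ≤ ℓ → ∃ M : ℝ, ∀ t : ℝ, |t| ^ k * |iteratedDeriv ℓ ℍ t| ≤ M := by
  obtain ⟨C, -, a, ha, hdecay⟩ := hdecay
  intro k ℓ hℓ
  exact (HasExpDecay.iteratedDeriv_of_ode ha (contDiff_infty_iff_deriv.1 hWsmooth).2 hHsmooth
    (fun t => Set.Ioo_subset_Icc_self (hHrange t)) hHode ⟨C, hdecay⟩ ℓ hℓ).exists_pow_mul_le ha k
end

section
/- Fix δ* ∈ (0,1) and a smooth cutoff χ : ℝ → [0,1] with χ(t) = 1 for t ∈ (−1,1) and supp χ ⊂ (−2,2). Assume there are C, a > 0 such that for all |t| ≥ 1: |ℍ(t) − sign(t)| + |ℍ'(t)| + |ℍ''(t)| + |ℍ'''(t)| + |ℍ''''(t)| + |ℍ'''''(t)| ≤ C e^{−a|t|}. For ε > 0 define the cut-off heteroclinic Ħ_ε(t) := χ(ε^{δ*} t) ℍ(t) + sign(t)(1 − χ(ε^{δ*} t)). Then Ħ_ε is smooth, and there are C' > 0 and ε₁ > 0 such that for every ε ∈ (0, ε₁) and every j ∈ {0,1,2,3}: sup_{t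 ∈ ℝ} | (d/dt)^j ( Ħ_ε''(t) − W'(Ħ_ε(t)) ) | ≤ C' ε³. -/
open Filter

lemma eventually_sign_eq {t : ℝ} (ht : t ≠ 0) : ∀ᶠ s in nhds t, Real.sign s = Real.sign t := by
  rcases ht.lt_or_gt with h | h
  · filter_upwards [Iio_mem_nhds h] with s hs
    rw [Real.sign_of_neg h, Real.sign_of_neg hs]
  · filter_upwards [Ioi_mem_nhds h] with s hs
    rw [Real.sign_of_pos h, Real.sign_of_pos hs]

lemma ContDiff.exists_bound_iteratedDeriv_on_compact {f : ℝ → ℝ} (hf : ContDiff ℝ (⊤ : ℕ∞) f)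
    {s : Set ℝ} (hs : IsCompact s) (n : ℕ) :
    ∃ M : ℝ, 0 < M ∧ ∀ i ≤ n, ∀ x ∈ s, |iteratedDeriv i f x| ≤ M := by
  have h (i : ℕ) : ∃ M : ℝ, ∀ x ∈ s, ‖iteratedDeriv i f x‖ ≤ M :=
    hs.exists_bound_of_continuousOn
      (hf.continuous_iteratedDeriv i (by exact_mod_cast le_top)).continuousOn
  choose M hM using h
  refine ⟨∑ i ∈ Finset.range (n + 1), |M i| + 1, by positivity, fun i hi x hx => ?_⟩
  have h1 := Finset.single_le_sum (f := fun i => |M i|) (fun i _ => abs_nonneg _)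
    (Finset.mem_range.2 (Nat.lt_succ_of_le hi))
  have h2 := hM i x hx
  rw [Real.norm_eq_abs] at h2
  have h3 := le_abs_self (M i)
  linarith

/-- A smooth function vanishing off a bounded interval has bounded derivatives. -/
lemma ContDiff.exists_bound_iteratedDeriv_of_support {f : ℝ → ℝ} (hf : ContDiff ℝ (⊤ : ℕ∞) f)
    {r : ℝ} (hsupp : ∀ t, f t ≠ 0 → t ∈ Set.Ioo (-r) r) (n : ℕ) :
    ∃ M : ℝ, 0 < M ∧ ∀ i ≤ n, ∀ x, |iteratedDeriv i f x| ≤ M := by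
  obtain ⟨M, hM, h⟩ :=
    hf.exists_bound_iteratedDeriv_on_compact (isCompact_Icc (a := -r) (b := r)) n
  refine ⟨M, hM, fun i hi x => ?_⟩
  by_cases hx : x ∈ Set.Icc (-r) r
  · exact h i hi x hx
  · have h0 : f =ᶠ[nhds x] fun _ => 0 := by
      filter_upwards [isClosed_Icc.isOpen_compl.mem_nhds hx] with y hy
      by_contra hne
      exact hy (Set.Ioo_subset_Icc_self (hsupp y hne))
    rw [h0.iteratedDeriv_eq, iteratedDeriv_const]
    simpa using hM.le

lemma abs_iteratedDeriv_mul_le {f g : ℝ → ℝ} (hf : ContDiff ℝ (⊤ : ℕ∞) f)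
    (hg : ContDiff ℝ (⊤ : ℕ∞) g) {t A B : ℝ} {n : ℕ} (hA : 0 ≤ A)
    (hfA : ∀ i ≤ n, |iteratedDeriv i f t| ≤ A) (hgB : ∀ i ≤ n, |iteratedDeriv i g t| ≤ B) :
    |iteratedDeriv n (fun s => f s * g s) t| ≤ 2 ^ n * (A * B) := by
  have h := norm_iteratedFDeriv_mul_le hf hg t (n := n) (by exact_mod_cast le_top)
  simp only [norm_iteratedFDeriv_eq_norm_iteratedDeriv, Real.norm_eq_abs] at h
  refine h.trans ?_
  have h2 : (2 : ℝ) ^ n = ∑ i ∈ Finset.range (n + 1), (n.choose i : ℝ) := by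
    exact_mod_cast (Nat.sum_range_choose n).symm
  rw [h2, Finset.sum_mul]
  refine Finset.sum_le_sum fun i hi => ?_
  rw [mul_assoc]
  gcongr
  · exact hfA i (Nat.lt_succ_iff.1 (Finset.mem_range.1 hi))
  · exact hgB _ (Nat.sub_le _ _)

lemma abs_iteratedDeriv_comp_const_mul_le {f : ℝ → ℝ} (hf : ContDiff ℝ (⊤ : ℕ∞) f) {η M : ℝ}
    (h0 : 0 ≤ η) (h1 : η ≤ 1) {i : ℕ} (hM : ∀ x, |iteratedDeriv i f x| ≤ M) (t : ℝ) :
    |iteratedDeriv i (fun s => f (η * s)) t| ≤ M := by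
  rw [iteratedDeriv_comp_const_mul (hf.of_le (by exact_mod_cast le_top)), abs_mul,
    abs_of_nonneg (by positivity)]
  exact (mul_le_of_le_one_left (abs_nonneg _) (pow_le_one₀ h0 h1)).trans (hM _)

/-- If `F` vanishes at `c` and `u` is small at `t` together with its first three derivatives, then
so is `F (c + u)`. -/
lemma abs_iteratedDeriv_comp_const_add_le {F u : ℝ → ℝ} (hF : ContDiff ℝ (⊤ : ℕ∞) F)
    (hu : ContDiff ℝ (⊤ : ℕ∞) u) {c t M K d : ℝ} (hc : c ∈ Set.Icc (-1 : ℝ) 1)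
    (hcu : c + u t ∈ Set.Icc (-1 : ℝ) 1) (hFc : F c = 0)
    (hM : ∀ i ≤ 3, ∀ x ∈ Set.Icc (-1 : ℝ) 1, |iteratedDeriv i F x| ≤ M) (hK : 1 ≤ K)
    (hd0 : 0 ≤ d) (hd1 : d ≤ 1) (hud : ∀ i ≤ 3, |iteratedDeriv i u t| ≤ K * d ^ 3)
    {j : ℕ} (hj : j ≤ 3) :
    |iteratedDeriv j (fun s => F (c + u s)) t| ≤ 6 * M * K ^ 3 * d := by
  have hM0 : 0 ≤ M := (abs_nonneg _).trans (hM 0 (by norm_num) c hc)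
  have hKK : K ≤ K ^ 3 := le_self_pow₀ hK (by norm_num)
  have hdd : d ^ 3 ≤ d := pow_le_of_le_one hd0 hd1 (by norm_num)
  rcases Nat.eq_zero_or_pos j with rfl | hj0
  · have hlip := Convex.norm_image_sub_le_of_norm_deriv_le (f := F) (C := M) (x := c)
      (y := c + u t) (fun x _ => hF.differentiable (by simp) x)
      (fun x hx => by simpa [iteratedDeriv_one] using hM 1 (by norm_num) x hx)
      (convex_Icc (-1 : ℝ) 1) hc hcu
    have h0 := hud 0 (by norm_num)
    simp only [iteratedDeriv_zero, Real.norm_eq_abs, hFc, sub_zero, add_sub_cancel_left]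
      at hlip h0 ⊢
    calc |F (c + u t)| ≤ M * |u t| := hlip
      _ ≤ M * (K ^ 3 * d) := by gcongr; exact h0.trans (by gcongr)
      _ ≤ 6 * (M * (K ^ 3 * d)) := by
        have : 0 ≤ M * (K ^ 3 * d) := by positivity
        linarith
      _ = _ := by ring
  · have h := norm_iteratedFDeriv_comp_le hF (contDiff_const.add hu : ContDiff ℝ (⊤ : ℕ∞)
      (fun s => c + u s)) (n := j) (by exact_mod_cast le_top) t (C := M) (D := K * d)
      (fun i hi => by
        rw [norm_iteratedFDeriv_eq_norm_iteratedDeriv]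
        exact hM i (hi.trans hj) _ hcu)
      (fun i hi hij => by
        rw [norm_iteratedFDeriv_eq_norm_iteratedDeriv, iteratedDeriv_const_add hi, mul_pow]
        refine (hud i (hij.trans hj)).trans ?_
        have h1 : K ≤ K ^ i := le_self_pow₀ hK (by omega)
        have h2 : d ^ 3 ≤ d ^ i := pow_le_pow_of_le_one hd0 hd1 (hij.trans hj)
        gcongr)
    rw [norm_iteratedFDeriv_eq_norm_iteratedDeriv] at h
    refine h.trans ?_
    have h6 : (j.factorial : ℝ) ≤ 6 := by exact_mod_cast Nat.factorial_le hj
    have h1 : K ^ j ≤ K ^ 3 := pow_le_pow_right₀ hK hj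
    have h2 : d ^ j ≤ d := pow_le_of_le_one hd0 hd1 (by omega)
    rw [mul_pow, ← mul_assoc]
    gcongr

/-- Exponential decay at distance at least `ε ^ (-δ)` beats every power of `ε`. -/
lemma exists_exp_neg_mul_abs_le {b δ : ℝ} (hb : 0 < b) (hδ : 0 < δ) :
    ∃ A > (0 : ℝ), ∀ ε : ℝ, 0 < ε → ε < 1 → ∀ t : ℝ, 1 ≤ ε ^ δ * |t| →
      Real.exp (-b * |t|) ≤ A * ε ^ 3 := by
  obtain ⟨n, hn⟩ := exists_nat_ge (3 / δ)
  rw [div_le_iff₀ hδ] at hn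
  refine ⟨n.factorial / b ^ n, by positivity, fun ε h0 h1 t ht => ?_⟩
  have hη : 0 < ε ^ δ := Real.rpow_pos_of_pos h0 δ
  have hηn : (ε ^ δ) ^ n ≤ ε ^ 3 := by
    rw [← Real.rpow_natCast, ← Real.rpow_mul h0.le, ← Real.rpow_natCast ε 3]
    exact Real.rpow_le_rpow_of_exponent_ge h0 h1.le (by push_cast; linarith)
  have ht0 : 0 < |t| := by
    by_contra hneg
    nlinarith
  have hexp := Real.pow_div_factorial_le_exp (b * |t|) (by positivity) n
  have hpow : 1 ≤ (ε ^ δ) ^ n * |t| ^ n := by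
    rw [← mul_pow]
    exact one_le_pow₀ ht
  calc Real.exp (-b * |t|) = (Real.exp (b * |t|))⁻¹ := by rw [neg_mul, Real.exp_neg]
    _ ≤ ((b * |t|) ^ n / n.factorial)⁻¹ := by gcongr
    _ = n.factorial / b ^ n * (|t| ^ n)⁻¹ := by rw [mul_pow]; field_simp
    _ ≤ n.factorial / b ^ n * (ε ^ δ) ^ n := by
      gcongr
      rw [inv_le_iff_one_le_mul₀ (by positivity)]
      exact hpow
    _ ≤ n.factorial / b ^ n * ε ^ 3 := by gcongr

lemma cutoff_eventuallyEq_of_ne_zero (χ ℍ : ℝ → ℝ) (η : ℝ) {t : ℝ} (ht : t ≠ 0) :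
    (fun r : ℝ => χ (η * r) * ℍ r + Real.sign r * (1 - χ (η * r))) =ᶠ[nhds t]
      fun r => Real.sign t + χ (η * r) * (ℍ r - Real.sign t) := by
  filter_upwards [eventually_sign_eq ht] with r hr
  rw [hr]
  ring

lemma cutoff_eventuallyEq_of_lt {χ : ℝ → ℝ} (ℍ : ℝ → ℝ)
    (hχone : ∀ t ∈ Set.Ioo (-1 : ℝ) 1, χ t = 1) {η t : ℝ} (ht : |η * t| < 1) :
    (fun r : ℝ => χ (η * r) * ℍ r + Real.sign r * (1 - χ (η * r))) =ᶠ[nhds t] ℍ := by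
  have hcont : Continuous fun r : ℝ => |η * r| := by fun_prop
  filter_upwards [hcont.continuousAt.eventually_lt continuousAt_const ht] with r hr
  rw [hχone _ (abs_lt.1 hr)]
  ring

/-- the cut-off heteroclinic `Ħ_ε(t) = χ(ε^{δ*}t)ℍ(t) + sign(t)(1 − χ(ε^{δ*}t))`
is smooth, and `Ħ_ε'' − W'(Ħ_ε)` is `O(ε³)` in `C³(ℝ)` as `ε → 0`. -/
theorem cutoff_heteroclinic_estimates
    (W ℍ : ℝ → ℝ)
    (hWsmooth : ContDiff ℝ (⊤ : ℕ∞) W)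
    (hWnonneg : ∀ x, 0 ≤ W x)
    (hWzero : ∀ x, W x = 0 ↔ x = 1 ∨ x = -1)
    (hW'zero : deriv W 0 = 0)
    (hW''zero : iteratedDeriv 2 W 0 ≠ 0)
    (hWwell : ∀ x : ℝ, 0 < |x| → |x| < 1 → x * deriv W x < 0)
    (hWconv : ∃ κ > (0:ℝ), ∃ β ∈ Set.Ioo (0:ℝ) 1, ∀ x : ℝ, 1 - β ≤ |x| → κ ≤ iteratedDeriv 2 W x)
    (hWsymm : ∀ x, W (-x) = W x)
    (hHsmooth : ContDiff ℝ (⊤ : ℕ∞) ℍ)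
    (hHrange : ∀ t, ℍ t ∈ Set.Ioo (-1:ℝ) 1)
    (hHode : ∀ t, iteratedDeriv 2 ℍ t = deriv W (ℍ t))
    (hHzero : ℍ 0 = 0)
    (hHmono : ∀ t, 0 < deriv ℍ t)
    (hHtop : Filter.Tendsto ℍ Filter.atTop (nhds 1))
    (hHbot : Filter.Tendsto ℍ Filter.atBot (nhds (-1)))
    (δ : ℝ) (hδ : δ ∈ Set.Ioo (0:ℝ) 1)
    (χ : ℝ → ℝ) (hχsmooth : ContDiff ℝ (⊤ : ℕ∞) χ)
    (hχ01 : ∀ t, χ t ∈ Set.Icc (0:ℝ) 1)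
    (hχone : ∀ t ∈ Set.Ioo (-1:ℝ) 1, χ t = 1)
    (hχsupp : ∀ t : ℝ, χ t ≠ 0 → t ∈ Set.Ioo (-2:ℝ) 2)
    (hdecay : ∃ C > (0:ℝ), ∃ a > (0:ℝ), ∀ t : ℝ, 1 ≤ |t| →
      |ℍ t - Real.sign t| + |deriv ℍ t| + |iteratedDeriv 2 ℍ t| + |iteratedDeriv 3 ℍ t|
        + |iteratedDeriv 4 ℍ t| + |iteratedDeriv 5 ℍ t| ≤ C * Real.exp (-a * |t|)) :
    (∀ ε : ℝ, 0 < ε → ContDiff ℝ (⊤ : ℕ∞)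
      (fun t : ℝ => χ (ε ^ δ * t) * ℍ t + Real.sign t * (1 - χ (ε ^ δ * t)))) ∧
    ∃ C' > (0:ℝ), ∃ ε₁ > (0:ℝ), ∀ ε : ℝ, 0 < ε → ε < ε₁ → ∀ j : ℕ, j ≤ 3 → ∀ t : ℝ,
      |iteratedDeriv j (fun s : ℝ =>
          iteratedDeriv 2
            (fun r : ℝ => χ (ε ^ δ * r) * ℍ r + Real.sign r * (1 - χ (ε ^ δ * r))) s
          - deriv W (χ (ε ^ δ * s) * ℍ s + Real.sign s * (1 - χ (ε ^ δ * s)))) t|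
        ≤ C' * ε ^ 3 := by
  have hW'smooth : ContDiff ℝ (⊤ : ℕ∞) (deriv W) := hWsmooth.iterate_deriv 1
  have hW'well (c : ℝ) (hc : c = 1 ∨ c = -1) : deriv W c = 0 := by
    refine IsLocalMin.deriv_eq_zero (Eventually.of_forall fun x => ?_)
    rw [(hWzero c).2 hc]
    exact hWnonneg x
  have hu (η c : ℝ) : ContDiff ℝ (⊤ : ℕ∞) fun r => χ (η * r) * (ℍ r - c) := by fun_prop
  constructor
  · intro ε hε
    refine contDiff_iff_contDiffAt.2 fun t => ?_
    by_cases ht : t = 0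
    · exact hHsmooth.contDiffAt.congr_of_eventuallyEq
        (cutoff_eventuallyEq_of_lt ℍ hχone (by simp [ht]))
    · exact (contDiff_const.add (hu _ _)).contDiffAt.congr_of_eventuallyEq
        (cutoff_eventuallyEq_of_ne_zero χ ℍ _ ht)
  obtain ⟨C, hC, a, ha, hdec⟩ := hdecay
  obtain ⟨X, hX, hχX⟩ := hχsmooth.exists_bound_iteratedDeriv_of_support hχsupp 5
  obtain ⟨M, hM, hWM⟩ :=
    hW'smooth.exists_bound_iteratedDeriv_on_compact (isCompact_Icc (a := (-1 : ℝ)) (b := 1)) 3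
  obtain ⟨A, hA, hdecA⟩ := exists_exp_neg_mul_abs_le (b := a / 3) (by positivity) hδ.1
  set K : ℝ := 2 ^ 5 * (X * C) + 1 with hKdef
  have hK : 1 ≤ K := by
    have : 0 < X * C := by positivity
    linarith
  refine ⟨(K + 6 * M * K ^ 3) * A, by positivity, 1, one_pos, fun ε hε hε1 j hj t => ?_⟩
  set η := ε ^ δ
  have hη : 0 < η := Real.rpow_pos_of_pos hε δ
  have hη1 : η < 1 := Real.rpow_lt_one hε.le hε1 hδ.1
  rcases lt_or_ge |η * t| 1 with ht | ht
  · have heq := cutoff_eventuallyEq_of_lt ℍ hχone ht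
    have herr : (fun s : ℝ => iteratedDeriv 2
        (fun r : ℝ => χ (η * r) * ℍ r + Real.sign r * (1 - χ (η * r))) s
          - deriv W (χ (η * s) * ℍ s + Real.sign s * (1 - χ (η * s)))) =ᶠ[nhds t]
        fun _ => 0 := by
      filter_upwards [heq, heq.iteratedDeriv 2] with s h1 h2
      rw [h2, h1, hHode, sub_self]
    rw [herr.iteratedDeriv_eq, iteratedDeriv_const]
    simp only [ite_self, abs_zero]
    positivity
  · rw [abs_mul, abs_of_pos hη] at ht
    have ht1 : 1 ≤ |t| := ht.trans (mul_le_of_le_one_left (abs_nonneg t) hη1.le)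
    have ht0 : t ≠ 0 := abs_pos.1 (by linarith)
    have hsign : Real.sign t = 1 ∨ Real.sign t = -1 := (Real.sign_apply_eq_of_ne_zero t ht0).symm
    have heq := cutoff_eventuallyEq_of_ne_zero χ ℍ η ht0
    set c := Real.sign t
    set u : ℝ → ℝ := fun r => χ (η * r) * (ℍ r - c) with hudef
    set d := Real.exp (-(a / 3) * |t|) with hddef
    have hd0 : 0 ≤ d := (Real.exp_pos _).le
    have hd1 : d ≤ 1 := Real.exp_le_one_iff.2 (by nlinarith)
    have hd3 : Real.exp (-a * |t|) = d ^ 3 := by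
      rw [hddef, ← Real.exp_nat_mul]
      congr 1
      push_cast
      ring
    have hdecv (i : ℕ) (hi : i ≤ 5) : |iteratedDeriv i (fun r => ℍ r - c) t| ≤ C * d ^ 3 := by
      have h := hdec t ht1
      rw [hd3, ← iteratedDeriv_one] at h
      have h0 := abs_nonneg (ℍ t - c)
      have h1 := abs_nonneg (iteratedDeriv 1 ℍ t)
      have h2 := abs_nonneg (iteratedDeriv 2 ℍ t)
      have h3 := abs_nonneg (iteratedDeriv 3 ℍ t)
      have h4 := abs_nonneg (iteratedDeriv 4 ℍ t)
      have h5 := abs_nonneg (iteratedDeriv 5 ℍ t)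
      rcases Nat.eq_zero_or_pos i with rfl | hi0
      · simp only [iteratedDeriv_zero]
        linarith
      · have : (fun r => ℍ r - c) = fun r => -c + ℍ r := by
          funext r
          ring
        rw [this, iteratedDeriv_const_add hi0]
        interval_cases i <;> linarith
    have hud (i : ℕ) (hi : i ≤ 5) : |iteratedDeriv i u t| ≤ K * d ^ 3 := by
      refine (abs_iteratedDeriv_mul_le (hχsmooth.comp (contDiff_const.mul contDiff_id))
        (hHsmooth.sub contDiff_const) hX.le
        (fun k hk => abs_iteratedDeriv_comp_const_mul_le hχsmooth hη.le hη1.le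
          (hχX k (hk.trans hi)) t)
        (fun k hk => hdecv k (hk.trans hi))).trans ?_
      have h2 : (2 : ℝ) ^ i ≤ 2 ^ 5 := pow_le_pow_right₀ one_le_two hi
      calc (2 : ℝ) ^ i * (X * (C * d ^ 3)) ≤ 2 ^ 5 * (X * (C * d ^ 3)) := by gcongr
        _ = 2 ^ 5 * (X * C) * d ^ 3 := by ring
        _ ≤ K * d ^ 3 := by gcongr; linarith
    have hc : c ∈ Set.Icc (-1 : ℝ) 1 := by
      rcases hsign with h | h <;> rw [h] <;> norm_num
    have hcu : c + u t ∈ Set.Icc (-1 : ℝ) 1 := by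
      have h := convex_Icc (-1 : ℝ) 1 (Set.Ioo_subset_Icc_self (hHrange t)) hc (hχ01 (η * t)).1
        (sub_nonneg.2 (hχ01 (η * t)).2) (by ring)
      convert h using 1
      simp only [hudef, smul_eq_mul]
      ring
    have herr : (fun s : ℝ => iteratedDeriv 2
        (fun r : ℝ => χ (η * r) * ℍ r + Real.sign r * (1 - χ (η * r))) s
          - deriv W (χ (η * s) * ℍ s + Real.sign s * (1 - χ (η * s)))) =ᶠ[nhds t]
        fun s => iteratedDeriv 2 u s - deriv W (c + u s) := by
      filter_upwards [heq, heq.iteratedDeriv 2] with s h1 h2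
      rw [h2, h1, iteratedDeriv_const_add two_pos]
    have hu2 : ContDiff ℝ (⊤ : ℕ∞) (iteratedDeriv 2 u) := by
      rw [iteratedDeriv_eq_iterate]
      exact (hu η c).iterate_deriv 2
    have hWu : ContDiff ℝ (⊤ : ℕ∞) fun s => deriv W (c + u s) :=
      hW'smooth.comp (contDiff_const.add (hu η c))
    have hlin : |iteratedDeriv j (iteratedDeriv 2 u) t| ≤ K * d ^ 3 := by
      have : iteratedDeriv j (iteratedDeriv 2 u) = iteratedDeriv (j + 2) u := by
        simp only [iteratedDeriv_eq_iterate, Function.iterate_add_apply]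
      rw [this]
      exact hud _ (by omega)
    have hnonlin := abs_iteratedDeriv_comp_const_add_le hW'smooth (hu η c) hc hcu
      (hW'well c hsign) hWM hK hd0 hd1 (fun i hi => hud i (by omega)) hj
    rw [herr.iteratedDeriv_eq, iteratedDeriv_fun_sub
      (hu2.contDiffAt.of_le (by exact_mod_cast le_top))
      (hWu.contDiffAt.of_le (by exact_mod_cast le_top))]
    have hdd : d ^ 3 ≤ d := pow_le_of_le_one hd0 hd1 (by norm_num)
    calc _ ≤ K * d ^ 3 + 6 * M * K ^ 3 * d := (abs_sub _ _).trans (add_le_add hlin hnonlin)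
      _ ≤ K * d + 6 * M * K ^ 3 * d := by gcongr
      _ = (K + 6 * M * K ^ 3) * d := by ring
      _ ≤ (K + 6 * M * K ^ 3) * (A * ε ^ 3) := by gcongr; exact hdecA ε hε hε1 t ht
      _ = _ := by ring
end

section
/- Let Ω ⊆ ℝⁿ be open, ε > 0, h : Ω → ℝ of class C¹, and let u : Ω → ℝ be a C² solution of ε² Δu = W'(u) + ε h on Ω. Then for every compactly supported C¹ vector field X : Ω → ℝⁿ, the first inner variation of the energy vanishes: ∫_Ω [ ( (ε/2)|∇u|² + ε^{−1} W(u) + h u ) div X − ε ⟨DX(∇u), ∇u⟩ + u ⟨∇h, X⟩ ] dx = 0, where DX denotes the Jacobian matrix of X. -/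
open MeasureTheory RealInnerProductSpace

/-- The Euclidean Laplacian on `EuclideanSpace ℝ (Fin n)`. -/
noncomputable def lapE {n : ℕ} (u : EuclideanSpace ℝ (Fin n) → ℝ)
    (x : EuclideanSpace ℝ (Fin n)) : ℝ :=
  ∑ i, fderiv ℝ (fun y => fderiv ℝ u y (EuclideanSpace.single i 1)) x
    (EuclideanSpace.single i 1)

/-- The Euclidean divergence of a vector field on `EuclideanSpace ℝ (Fin n)`. -/
noncomputable def divE {n : ℕ}
    (X : EuclideanSpace ℝ (Fin n) → EuclideanSpace ℝ (Fin n))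
    (x : EuclideanSpace ℝ (Fin n)) : ℝ :=
  ∑ i, @inner ℝ _ _ (fderiv ℝ X x (EuclideanSpace.single i 1)) (EuclideanSpace.single i 1)

theorem divE_smul {n : ℕ} {f : EuclideanSpace ℝ (Fin n) → ℝ}
    {Y : EuclideanSpace ℝ (Fin n) → EuclideanSpace ℝ (Fin n)} {x : EuclideanSpace ℝ (Fin n)}
    (hf : DifferentiableAt ℝ f x) (hY : DifferentiableAt ℝ Y x) :
    divE (fun y => f y • Y y) x = f x * divE Y x + fderiv ℝ f x (Y x) := by
  have hdual : fderiv ℝ f x (Y x) =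
      ∑ i, fderiv ℝ f x (EuclideanSpace.single i 1) * Y x i := by
    conv_lhs => rw [← (EuclideanSpace.basisFun (Fin n) ℝ).sum_repr (Y x)]
    simp [mul_comm]
  rw [hdual]
  simp only [divE, fderiv_fun_smul hf hY, Finset.mul_sum, ← Finset.sum_add_distrib]
  refine Finset.sum_congr rfl fun i _ => ?_
  simp [inner_add_left, inner_smul_left, EuclideanSpace.inner_single_right]

theorem divE_sub {n : ℕ} {Y Z : EuclideanSpace ℝ (Fin n) → EuclideanSpace ℝ (Fin n)}
    {x : EuclideanSpace ℝ (Fin n)}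
    (hY : DifferentiableAt ℝ Y x) (hZ : DifferentiableAt ℝ Z x) :
    divE (fun y => Y y - Z y) x = divE Y x - divE Z x := by
  simp [divE, fderiv_fun_sub hY hZ, inner_sub_left]

/-- The divergence of a compactly supported `C¹` vector field integrates to zero. -/
theorem integral_divE_eq_zero {n : ℕ}
    {V : EuclideanSpace ℝ (Fin n) → EuclideanSpace ℝ (Fin n)}
    (hV : ContDiff ℝ 1 V) (hVc : HasCompactSupport V) : ∫ x, divE V x = 0 := by
  have hd : Continuous (fderiv ℝ V) := hV.continuous_fderiv one_ne_zero
  have hdc : HasCompactSupport (fderiv ℝ V) := hVc.fderiv ℝ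
  have key : ∀ i : Fin n, Integrable (fun x =>
      ⟪fderiv ℝ V x (EuclideanSpace.single i 1), EuclideanSpace.single i (1 : ℝ)⟫) ∧
      ∫ x, ⟪fderiv ℝ V x (EuclideanSpace.single i 1), EuclideanSpace.single i (1 : ℝ)⟫ = 0 := by
    intro i
    set b : EuclideanSpace ℝ (Fin n) := EuclideanSpace.single i 1
    have hint : Integrable (fun x => ⟪fderiv ℝ V x b, b⟫) := by
      refine Continuous.integrable_of_hasCompactSupport (by fun_prop) ?_
      exact hdc.comp_left (g := fun L : EuclideanSpace ℝ (Fin n) →L[ℝ] _ => ⟪L b, b⟫) (by simp)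
    have hint' : Integrable (fun x => ⟪V x, b⟫) := by
      refine Continuous.integrable_of_hasCompactSupport (hV.continuous.inner continuous_const) ?_
      exact hVc.comp_left (g := fun v : EuclideanSpace ℝ (Fin n) => ⟪v, b⟫) (by simp)
    have hder : ∀ x, fderiv ℝ (fun x => ⟪V x, b⟫) x b = ⟪fderiv ℝ V x b, b⟫ := by
      intro x
      rw [fderiv_inner_apply ℝ (hV.differentiable one_ne_zero x) (differentiableAt_const b)]
      simp
    refine ⟨hint, ?_⟩
    have := integral_mul_fderiv_eq_neg_fderiv_mul_of_integrable
      (μ := (volume : Measure (EuclideanSpace ℝ (Fin n))))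
      (f := fun _ => (1 : ℝ)) (g := fun x => ⟪V x, b⟫) (v := b)
      (by simp) (by simpa [hder] using hint) (by simpa using hint')
      (fun x _ => differentiableAt_const _)
      (fun x _ => (hV.differentiable one_ne_zero x).inner ℝ (differentiableAt_const b))
    simpa [hder] using this
  simp only [divE]
  rw [integral_finsetSum _ fun i _ => (key i).1]
  exact Finset.sum_eq_zero fun i _ => (key i).2

theorem contDiffAt_gradient {n : ℕ} {u : EuclideanSpace ℝ (Fin n) → ℝ}
    {x : EuclideanSpace ℝ (Fin n)} (hu : ContDiffAt ℝ 2 u x) :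
    ContDiffAt ℝ 1 (gradient u) x := by
  have h1 : ContDiffAt ℝ 1 (fderiv ℝ u) x := hu.fderiv_right (by norm_num)
  exact (InnerProductSpace.toDual ℝ
    (EuclideanSpace ℝ (Fin n))).symm.toContinuousLinearEquiv.contDiff.contDiffAt.comp x h1

theorem inner_fderiv_gradient {n : ℕ} {u : EuclideanSpace ℝ (Fin n) → ℝ}
    {x : EuclideanSpace ℝ (Fin n)} (hu : ContDiffAt ℝ 2 u x) (a b : EuclideanSpace ℝ (Fin n)) :
    ⟪fderiv ℝ (gradient u) x a, b⟫ = fderiv ℝ (fderiv ℝ u) x a b := by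
  have h1 : DifferentiableAt ℝ (fderiv ℝ u) x :=
    (hu.fderiv_right (m := 1) (by norm_num)).differentiableAt one_ne_zero
  have h2 : DifferentiableAt ℝ (gradient u) x :=
    (contDiffAt_gradient hu).differentiableAt one_ne_zero
  have h3 : fderiv ℝ (fun y => ⟪gradient u y, b⟫) x a = ⟪fderiv ℝ (gradient u) x a, b⟫ := by
    rw [fderiv_inner_apply ℝ h2 (differentiableAt_const b)]
    simp
  have h4 : (fun y => ⟪gradient u y, b⟫) = fun y => fderiv ℝ u y b := by
    ext y; simp [gradient]
  rw [← h3, h4, fderiv_clm_apply h1 (differentiableAt_const b)]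
  simp

theorem divE_gradient {n : ℕ} {u : EuclideanSpace ℝ (Fin n) → ℝ}
    {x : EuclideanSpace ℝ (Fin n)} (hu : ContDiffAt ℝ 2 u x) :
    divE (gradient u) x = lapE u x := by
  have h1 : DifferentiableAt ℝ (fderiv ℝ u) x :=
    (hu.fderiv_right (m := 1) (by norm_num)).differentiableAt one_ne_zero
  refine Finset.sum_congr rfl fun i _ => ?_
  rw [inner_fderiv_gradient hu, fderiv_clm_apply h1 (differentiableAt_const _)]
  simp

theorem inner_fderiv_gradient_comm {n : ℕ} {u : EuclideanSpace ℝ (Fin n) → ℝ}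
    {x : EuclideanSpace ℝ (Fin n)} (hu : ContDiffAt ℝ 2 u x) (a b : EuclideanSpace ℝ (Fin n)) :
    ⟪fderiv ℝ (gradient u) x a, b⟫ = ⟪fderiv ℝ (gradient u) x b, a⟫ := by
  rw [inner_fderiv_gradient hu, inner_fderiv_gradient hu]
  exact (hu.isSymmSndFDerivAt (by simp)) a b

/-- The Allen–Cahn energy density with prescribed-mean-curvature term. -/
noncomputable def energyDensity {n : ℕ} (W : ℝ → ℝ) (ε : ℝ)
    (h u : EuclideanSpace ℝ (Fin n) → ℝ) (x : EuclideanSpace ℝ (Fin n)) : ℝ :=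
  ε / 2 * ‖gradient u x‖ ^ 2 + ε⁻¹ * W (u x) + h x * u x

theorem contDiffAt_energyDensity {n : ℕ} {W : ℝ → ℝ} (ε : ℝ)
    {h u : EuclideanSpace ℝ (Fin n) → ℝ} {x : EuclideanSpace ℝ (Fin n)}
    (hW : ContDiff ℝ 1 W) (hh : ContDiffAt ℝ 1 h x) (hu : ContDiffAt ℝ 2 u x) :
    ContDiffAt ℝ 1 (energyDensity W ε h u) x := by
  have hu1 : ContDiffAt ℝ 1 u x := hu.of_le (by norm_num)
  have hWu : ContDiffAt ℝ 1 (fun y => W (u y)) x := hW.contDiffAt.comp x hu1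
  exact ((contDiffAt_const.mul ((contDiffAt_gradient hu).norm_sq ℝ)).add
    (contDiffAt_const.mul hWu)).add (hh.mul hu1)

theorem fderiv_energyDensity {n : ℕ} {W : ℝ → ℝ} (ε : ℝ)
    {h u : EuclideanSpace ℝ (Fin n) → ℝ} {x : EuclideanSpace ℝ (Fin n)}
    (hW : DifferentiableAt ℝ W (u x)) (hh : DifferentiableAt ℝ h x) (hu : ContDiffAt ℝ 2 u x)
    (v : EuclideanSpace ℝ (Fin n)) :
    fderiv ℝ (energyDensity W ε h u) x v =
      ε * ⟪fderiv ℝ (gradient u) x v, gradient u x⟫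
        + (ε⁻¹ * deriv W (u x) + h x) * ⟪gradient u x, v⟫ + u x * ⟪gradient h x, v⟫ := by
  have hG : HasFDerivAt (gradient u) (fderiv ℝ (gradient u) x) x :=
    ((contDiffAt_gradient hu).differentiableAt one_ne_zero).hasFDerivAt
  have hu1 : HasFDerivAt u (fderiv ℝ u x) x := (hu.differentiableAt two_ne_zero).hasFDerivAt
  have hd := ((hG.norm_sq.const_mul (ε / 2)).add
    ((hW.hasDerivAt.comp_hasFDerivAt x hu1).const_mul ε⁻¹)).add (hh.hasFDerivAt.mul hu1)
  have hd' : HasFDerivAt (energyDensity W ε h u) _ x := hd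
  have hgu : ⟪gradient u x, v⟫ = fderiv ℝ u x v := by simp [gradient]
  have hgh : ⟪gradient h x, v⟫ = fderiv ℝ h x v := by simp [gradient]
  rw [hd'.fderiv, hgu, hgh, real_inner_comm]
  simp
  ring

/-- The Noether current of the Allen–Cahn energy along the vector field `X`. -/
noncomputable def innerVariationField {n : ℕ} (W : ℝ → ℝ) (ε : ℝ)
    (h u : EuclideanSpace ℝ (Fin n) → ℝ)
    (X : EuclideanSpace ℝ (Fin n) → EuclideanSpace ℝ (Fin n))
    (x : EuclideanSpace ℝ (Fin n)) : EuclideanSpace ℝ (Fin n) :=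
  energyDensity W ε h u x • X x - (ε * ⟪gradient u x, X x⟫) • gradient u x

theorem contDiffAt_innerVariationField {n : ℕ} {W : ℝ → ℝ} (ε : ℝ)
    {h u : EuclideanSpace ℝ (Fin n) → ℝ}
    {X : EuclideanSpace ℝ (Fin n) → EuclideanSpace ℝ (Fin n)} {x : EuclideanSpace ℝ (Fin n)}
    (hW : ContDiff ℝ 1 W) (hh : ContDiffAt ℝ 1 h x) (hu : ContDiffAt ℝ 2 u x)
    (hX : ContDiffAt ℝ 1 X x) : ContDiffAt ℝ 1 (innerVariationField W ε h u X) x :=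
  ((contDiffAt_energyDensity ε hW hh hu).smul hX).sub
    ((contDiffAt_const.mul ((contDiffAt_gradient hu).inner ℝ hX)).smul (contDiffAt_gradient hu))

theorem divE_innerVariationField {n : ℕ} {W : ℝ → ℝ} {ε : ℝ} (hε : ε ≠ 0)
    {h u : EuclideanSpace ℝ (Fin n) → ℝ}
    {X : EuclideanSpace ℝ (Fin n) → EuclideanSpace ℝ (Fin n)} {x : EuclideanSpace ℝ (Fin n)}
    (hW : ContDiff ℝ 1 W) (hh : ContDiffAt ℝ 1 h x) (hu : ContDiffAt ℝ 2 u x)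
    (hX : ContDiffAt ℝ 1 X x) (hpde : ε ^ 2 * lapE u x = deriv W (u x) + ε * h x) :
    divE (innerVariationField W ε h u X) x =
      energyDensity W ε h u x * divE X x
        - ε * ⟪fderiv ℝ X x (gradient u x), gradient u x⟫ + u x * ⟪gradient h x, X x⟫ := by
  have hE := (contDiffAt_energyDensity ε hW hh hu).differentiableAt one_ne_zero
  have hG := (contDiffAt_gradient hu).differentiableAt one_ne_zero
  have hXd := hX.differentiableAt one_ne_zero
  have hI : DifferentiableAt ℝ (fun y => ⟪gradient u y, X y⟫) x := hG.inner ℝ hXd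
  have hlap : ε⁻¹ * deriv W (u x) + h x = ε * lapE u x := by
    field_simp
    linarith
  have hsub : divE (innerVariationField W ε h u X) x =
      divE (fun y => energyDensity W ε h u y • X y) x -
        divE (fun y => (ε * ⟪gradient u y, X y⟫) • gradient u y) x :=
    divE_sub (hE.smul hXd) ((hI.const_mul ε).smul hG)
  rw [hsub, divE_smul hE hXd,
    divE_smul (hI.const_mul ε) hG, divE_gradient hu,
    fderiv_energyDensity ε (hW.differentiable one_ne_zero _) (hh.differentiableAt one_ne_zero) hu,
    fderiv_const_mul hI, hlap]
  simp only [smul_apply, smul_eq_mul, fderiv_inner_apply ℝ hG hXd]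
  rw [inner_fderiv_gradient_comm hu (X x), real_inner_comm (gradient u x) (fderiv ℝ X x _)]
  ring

/-- vanishing of the first inner variation of the Allen–Cahn energy at a
solution of `ε²Δu = W'(u) + εh`:
`∫ [(ε/2|∇u|² + ε⁻¹W(u) + hu) div X − ε⟨DX(∇u),∇u⟩ + u⟨∇h,X⟩] = 0`. -/
theorem first_inner_variation_vanishes
    (n : ℕ)
    (W : ℝ → ℝ)
    (hWsmooth : ContDiff ℝ (⊤ : ℕ∞) W)
    (hWnonneg : ∀ x, 0 ≤ W x)
    (hWzero : ∀ x, W x = 0 ↔ x = 1 ∨ x = -1)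
    (hW'zero : deriv W 0 = 0)
    (hW''zero : iteratedDeriv 2 W 0 ≠ 0)
    (hWwell : ∀ x : ℝ, 0 < |x| → |x| < 1 → x * deriv W x < 0)
    (hWconv : ∃ κ > (0:ℝ), ∃ β ∈ Set.Ioo (0:ℝ) 1, ∀ x : ℝ, 1 - β ≤ |x| → κ ≤ iteratedDeriv 2 W x)
    (hWsymm : ∀ x, W (-x) = W x)
    (Ω : Set (EuclideanSpace ℝ (Fin n))) (hΩ : IsOpen Ω)
    (ε : ℝ) (hε : 0 < ε)
    (h : EuclideanSpace ℝ (Fin n) → ℝ) (hh : ContDiffOn ℝ 1 h Ω)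
    (u : EuclideanSpace ℝ (Fin n) → ℝ) (hu : ContDiffOn ℝ 2 u Ω)
    (hpde : ∀ x ∈ Ω, ε ^ 2 * lapE u x = deriv W (u x) + ε * h x)
    (X : EuclideanSpace ℝ (Fin n) → EuclideanSpace ℝ (Fin n))
    (hX : ContDiff ℝ 1 X) (hXc : HasCompactSupport X) (hXΩ : tsupport X ⊆ Ω) :
    (∫ x in Ω,
      ((ε / 2 * ‖gradient u x‖ ^ 2 + ε⁻¹ * W (u x) + h x * u x) * divE X x
        - ε * ⟪fderiv ℝ X x (gradient u x), gradient u x⟫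
        + u x * ⟪gradient h x, X x⟫)) = 0 := by
  have hW1 : ContDiff ℝ 1 W := hWsmooth.of_le (by exact_mod_cast le_top)
  have hhx : ∀ x ∈ Ω, ContDiffAt ℝ 1 h x := fun x hx => hh.contDiffAt (hΩ.mem_nhds hx)
  have hux : ∀ x ∈ Ω, ContDiffAt ℝ 2 u x := fun x hx => hu.contDiffAt (hΩ.mem_nhds hx)
  have hsupp : Function.support (innerVariationField W ε h u X) ⊆ Function.support X := by
    intro x hx hX0
    exact hx (by simp [innerVariationField, hX0])
  have hts : tsupport (innerVariationField W ε h u X) ⊆ tsupport X := closure_mono hsupp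
  have hV : ContDiff ℝ 1 (innerVariationField W ε h u X) := by
    refine contDiff_iff_contDiffAt.2 fun x => ?_
    by_cases hx : x ∈ Ω
    · exact contDiffAt_innerVariationField ε hW1 (hhx x hx) (hux x hx) hX.contDiffAt
    · refine (contDiffAt_const (c := 0)).congr_of_eventuallyEq ?_
      exact notMem_tsupport_iff_eventuallyEq.1 fun hm => hx (hXΩ (hts hm))
  have hVc : HasCompactSupport (innerVariationField W ε h u X) := hXc.mono hsupp
  have hzero : ∀ x, x ∉ Ω → divE (innerVariationField W ε h u X) x = 0 := by
    intro x hx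
    have hz : fderiv ℝ (innerVariationField W ε h u X) x = 0 := by
      by_contra hne
      exact hx (hXΩ (hts (support_fderiv_subset ℝ hne)))
    simp [divE, hz]
  rw [← integral_divE_eq_zero hV hVc, ← setIntegral_eq_integral_of_forall_compl_eq_zero hzero]
  refine setIntegral_congr_fun hΩ.measurableSet fun x hx => ?_
  exact (divE_innerVariationField hε.ne' hW1 (hhx x hx) (hux x hx) hX.contDiffAt
    (hpde x hx)).symm
end

section
/- Let 𝕀 : ℝ → ℝ be a bounded C² function satisfying 𝕀''(t) − W''(ℍ(t)) 𝕀(t) = 1 − 2 𝔢₀^{−1} ℍ'(t) for all t ∈ ℝ. If 𝕀(t) converges to a limit L as t → +∞, then L = −1/W''(1). (Similarly, if 𝕀(t) converges as t → −∞, the limit is −1/W''(−1).) -/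
open MeasureTheory Filter

/-- If a function converges at `+∞` and its second derivative converges there too, then the limit
of the second derivative is zero. -/
theorem second_deriv_limit_eq_zero_of_tendsto_atTop {f g h : ℝ → ℝ} {L c : ℝ}
    (hf : ∀ x, HasDerivAt f (g x) x) (hg : ∀ x, HasDerivAt g (h x) x)
    (hfL : Tendsto f atTop (nhds L)) (hhc : Tendsto h atTop (nhds c)) : c = 0 := by
  have hξ : ∀ t : ℝ, ∃ x ∈ Set.Ioo t (t + 1), g x = f (t + 1) - f t := fun t => by
    obtain ⟨x, hx, hgx⟩ := exists_hasDerivAt_eq_slope f g (lt_add_one t)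
      (fun x _ => (hf x).continuousAt.continuousWithinAt) (fun x _ => hf x)
    exact ⟨x, hx, by simpa using hgx⟩
  choose ξ hξmem hξ using hξ
  have hgξ : Tendsto (fun t => g (ξ t)) atTop (nhds 0) := by
    have hdiff := (hfL.comp (tendsto_atTop_add_const_right atTop 1 tendsto_id)).sub hfL
    simpa [hξ] using hdiff
  have hη : ∀ t : ℝ, ∃ y, t < y ∧ |h y| ≤ |g (ξ (t + 2)) - g (ξ t)| := fun t => by
    have hgap : 1 ≤ ξ (t + 2) - ξ t := by
      linarith [(hξmem t).2, (hξmem (t + 2)).1]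
    obtain ⟨y, hy, hhy⟩ := exists_hasDerivAt_eq_slope g h (show ξ t < ξ (t + 2) by linarith)
      (fun x _ => (hg x).continuousAt.continuousWithinAt) (fun x _ => hg x)
    refine ⟨y, (hξmem t).1.trans hy.1, ?_⟩
    rw [hhy, abs_div]
    exact div_le_self (abs_nonneg _) (hgap.trans (le_abs_self _))
  choose η hηlt hη using hη
  have hbound : Tendsto (fun t => |g (ξ (t + 2)) - g (ξ t)|) atTop (nhds 0) := by
    simpa using ((hgξ.comp (tendsto_atTop_add_const_right atTop 2 tendsto_id)).sub hgξ).abs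
  have hzero : Tendsto (fun t => h (η t)) atTop (nhds 0) :=
    squeeze_zero_norm hη hbound
  exact tendsto_nhds_unique
    (hhc.comp (tendsto_atTop_mono (fun t => (hηlt t).le) tendsto_id)) hzero

/-- The analogue at `-∞` of `second_deriv_limit_eq_zero_of_tendsto_atTop`. -/
theorem second_deriv_limit_eq_zero_of_tendsto_atBot {f g h : ℝ → ℝ} {L c : ℝ}
    (hf : ∀ x, HasDerivAt f (g x) x) (hg : ∀ x, HasDerivAt g (h x) x)
    (hfL : Tendsto f atBot (nhds L)) (hhc : Tendsto h atBot (nhds c)) : c = 0 := by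
  refine second_deriv_limit_eq_zero_of_tendsto_atTop (f := fun x => f (-x))
    (g := fun x => -g (-x)) (h := fun x => h (-x)) (fun x => ?_) (fun x => ?_)
    (hfL.comp tendsto_neg_atTop_atBot) (hhc.comp tendsto_neg_atTop_atBot)
  · exact ((hf (-x)).comp x (hasDerivAt_neg x)).congr_deriv (by ring)
  · exact ((hg (-x)).comp x (hasDerivAt_neg x)).neg.congr_deriv (by ring)

/-- a bounded C² solution of `𝕀'' − W''(ℍ)𝕀 = 1 − 2𝔢₀⁻¹ℍ'` that converges
at `+∞` (resp. `−∞`) must have limit `−1/W''(1)` (resp. `−1/W''(−1)`). -/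
theorem correction_function_limits
    (W ℍ : ℝ → ℝ)
    (hWsmooth : ContDiff ℝ (⊤ : ℕ∞) W)
    (hWnonneg : ∀ x, 0 ≤ W x)
    (hWzero : ∀ x, W x = 0 ↔ x = 1 ∨ x = -1)
    (hW'zero : deriv W 0 = 0)
    (hW''zero : iteratedDeriv 2 W 0 ≠ 0)
    (hWwell : ∀ x : ℝ, 0 < |x| → |x| < 1 → x * deriv W x < 0)
    (hWconv : ∃ κ > (0:ℝ), ∃ β ∈ Set.Ioo (0:ℝ) 1, ∀ x : ℝ, 1 - β ≤ |x| → κ ≤ iteratedDeriv 2 W x)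
    (hWsymm : ∀ x, W (-x) = W x)
    (hHsmooth : ContDiff ℝ (⊤ : ℕ∞) ℍ)
    (hHrange : ∀ t, ℍ t ∈ Set.Ioo (-1:ℝ) 1)
    (hHode : ∀ t, iteratedDeriv 2 ℍ t = deriv W (ℍ t))
    (hHzero : ℍ 0 = 0)
    (hHmono : ∀ t, 0 < deriv ℍ t)
    (hHtop : Filter.Tendsto ℍ Filter.atTop (nhds 1))
    (hHbot : Filter.Tendsto ℍ Filter.atBot (nhds (-1)))
    (hH'top : Tendsto (deriv ℍ) atTop (nhds 0))
    (hH'bot : Tendsto (deriv ℍ) atBot (nhds 0))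
    (𝕀 : ℝ → ℝ) (hI : ContDiff ℝ 2 𝕀)
    (hIbdd : ∃ M : ℝ, ∀ t : ℝ, |𝕀 t| ≤ M)
    (hIode : ∀ t : ℝ, iteratedDeriv 2 𝕀 t - iteratedDeriv 2 W (ℍ t) * 𝕀 t
      = 1 - 2 * (∫ s : ℝ, (deriv ℍ s) ^ 2)⁻¹ * deriv ℍ t) :
    (∀ L : ℝ, Tendsto 𝕀 atTop (nhds L) → L = -1 / iteratedDeriv 2 W 1) ∧
    (∀ L : ℝ, Tendsto 𝕀 atBot (nhds L) → L = -1 / iteratedDeriv 2 W (-1)) := by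
  have hI1 : ∀ x, HasDerivAt 𝕀 (deriv 𝕀 x) x := fun x =>
    (hI.differentiable (by norm_num) x).hasDerivAt
  have hI2 : ∀ x, HasDerivAt (deriv 𝕀) (iteratedDeriv 2 𝕀 x) x := fun x => by
    have hd : Differentiable ℝ (iteratedDeriv 1 𝕀) :=
      hI.differentiable_iteratedDeriv 1 (by norm_num)
    rw [iteratedDeriv_succ, iteratedDeriv_one]
    rw [iteratedDeriv_one] at hd
    exact (hd x).hasDerivAt
  have hW2 : Continuous (iteratedDeriv 2 W) :=
    (contDiff_infty.1 hWsmooth 2).continuous_iteratedDeriv 2 le_rfl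
  have hI2lim : ∀ (l : Filter ℝ) (a L : ℝ), Tendsto ℍ l (nhds a) →
      Tendsto (deriv ℍ) l (nhds 0) → Tendsto 𝕀 l (nhds L) →
      Tendsto (iteratedDeriv 2 𝕀) l (nhds (1 + iteratedDeriv 2 W a * L)) := by
    intro l a L hH hH' hIL
    have hrhs := (hH'.const_mul (2 * (∫ s : ℝ, (deriv ℍ s) ^ 2)⁻¹)).const_sub 1
    have hsum := hrhs.add (((hW2.tendsto a).comp hH).mul hIL)
    rw [mul_zero, sub_zero] at hsum
    exact hsum.congr fun t => by simp only [Function.comp_apply]; linarith [hIode t]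
  obtain ⟨κ, hκ, β, hβ, hconv⟩ := hWconv
  have hpos : ∀ a : ℝ, |a| = 1 → 0 < iteratedDeriv 2 W a := fun a ha =>
    hκ.trans_le (hconv a (by linarith [hβ.1]))
  have hsolve : ∀ a L : ℝ, |a| = 1 → 1 + iteratedDeriv 2 W a * L = 0 →
      L = -1 / iteratedDeriv 2 W a := fun a L ha h => by
    rw [eq_div_iff (hpos a ha).ne']
    linarith
  exact ⟨fun L hL => hsolve 1 L (by simp) <|
      second_deriv_limit_eq_zero_of_tendsto_atTop hI1 hI2 hL (hI2lim _ _ _ hHtop hH'top hL),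
    fun L hL => hsolve (-1) L (by simp) <|
      second_deriv_limit_eq_zero_of_tendsto_atBot hI1 hI2 hL (hI2lim _ _ _ hHbot hH'bot hL)⟩
end
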